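/- Let G and H be q-split groups of nilpotence class two. Then G and H are isomorphic in the category Niq — i.e. there exist q-maps f : G → H and g : H → G with g∘f = id_G and f∘g = id_H — if and only if G and H are similar, i.e. there exist a group isomorphism G_ab ≅ H_ab and a group isomorphism [G,G] ≅ [H,H]. -/

import Mathlib

/-- The cross-effect of a map between groups: `(a|b)_f = (f a * f b)⁻¹ * f (a*b)`. -/
def crossEff {G H : Type*} [Group G] [Group H] (f : G → H) (a b : G) : H :=
  (f a * f b)⁻¹ * f (a * b)

/-- The commutator `[a,b] = a⁻¹ * b⁻¹ * a * b`. -/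
def cmt {G : Type*} [Group G] (a b : G) : G := a⁻¹ * b⁻¹ * a * b

/-- A map between groups is weakly quadratic if its cross-effect commutes with all values
of `f` and is multiplicative in each variable. -/
def IsWeaklyQuadratic {G H : Type*} [Group G] [Group H] (f : G → H) : Prop :=
  (∀ a b c : G, Commute (crossEff f a b) (f c)) ∧
  (∀ a a' b : G, crossEff f (a * a') b = crossEff f a b * crossEff f a' b) ∧
  (∀ a b b' : G, crossEff f a (b * b') = crossEff f a b * crossEff f a b')

/-- A quadratic map: weakly quadratic with central cross-effect values. -/
def IsQuadratic {G H : Type*} [Group G] [Group H] (f : G → H) : Prop :=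
  IsWeaklyQuadratic f ∧ ∀ a b : G, crossEff f a b ∈ Subgroup.center H

/-- A q-map: weakly quadratic with cross-effect values in the commutator subgroup. -/
def IsQMap {G H : Type*} [Group G] [Group H] (f : G → H) : Prop :=
  IsWeaklyQuadratic f ∧ ∀ a b : G, crossEff f a b ∈ commutator H

/-- A nil₂-group is q-split if the projection onto its abelianization admits a
quadratic section. -/
def QSplit (G : Type*) [Group G] : Prop :=
  ∃ s : Abelianization G → G, IsQuadratic s ∧ ∀ x : Abelianization G, Abelianization.of (s x) = x

theorem map_mul_eq_mul_crossEff {G H : Type*} [Group G] [Group H] (f : G → H) (a b : G) :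
    f (a * b) = f a * f b * crossEff f a b := by
  rw [crossEff, mul_inv_cancel_left]

theorem mem_commutator_iff_abelianization_of_eq_one {G : Type*} [Group G] (x : G) :
    x ∈ commutator G ↔ Abelianization.of x = 1 := by
  rw [← Abelianization.ker_of, MonoidHom.mem_ker]

theorem commute_of_mem_commutator {G : Type*} [Group G]
    (hG : commutator G ≤ Subgroup.center G) {c : G} (hc : c ∈ commutator G) (x : G) :
    c * x = x * c :=
  (Subgroup.mem_center_iff.mp (hG hc) x).symm

namespace IsQMap

variable {G H : Type*} [Group G] [Group H] {f : G → H}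

/-- A q-map becomes a homomorphism after projecting to the abelianization of the target. -/
def toAbelianization (hf : IsQMap f) : G →* Abelianization H :=
  MonoidHom.mk' (fun x => Abelianization.of (f x)) fun a b => by
    rw [map_mul_eq_mul_crossEff f, map_mul, map_mul,
      (mem_commutator_iff_abelianization_of_eq_one _).mp (hf.2 a b), mul_one]

/-- The homomorphism induced by a q-map on abelianizations. -/
def abelianizationMap (hf : IsQMap f) : Abelianization G →* Abelianization H :=
  Abelianization.lift hf.toAbelianization

theorem abelianizationMap_of (hf : IsQMap f) (x : G) :
    hf.abelianizationMap (Abelianization.of x) = Abelianization.of (f x) :=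
  Abelianization.lift_apply_of hf.toAbelianization x

theorem map_mem_commutator (hf : IsQMap f) {x : G} (hx : x ∈ commutator G) :
    f x ∈ commutator H := by
  rw [mem_commutator_iff_abelianization_of_eq_one] at hx ⊢
  rw [← hf.abelianizationMap_of, hx, map_one]

open scoped IsMulCommutative in
theorem crossEff_eq_one_of_mem_commutator (hf : IsQMap f)
    (hH : commutator H ≤ Subgroup.center H) {a : G} (ha : a ∈ commutator G) (b : G) :
    crossEff f a b = 1 := by
  let φ : G →* Subgroup.center H :=
    MonoidHom.mk' (fun x => ⟨crossEff f x b, hH (hf.2 x b)⟩)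
      fun x y => Subtype.ext (hf.1.2.1 x y b)
  have h := Abelianization.commutator_subset_ker φ ha
  exact congrArg Subtype.val (MonoidHom.mem_ker.mp h)

/-- The homomorphism obtained by restricting a q-map to commutator subgroups. -/
def commutatorMap (hf : IsQMap f) (hH : commutator H ≤ Subgroup.center H) :
    commutator G →* commutator H :=
  MonoidHom.mk' (fun x => ⟨f x, hf.map_mem_commutator x.2⟩) fun a b => Subtype.ext <| by
    simp [map_mul_eq_mul_crossEff f, hf.crossEff_eq_one_of_mem_commutator hH a.2]

end IsQMap

section Twist

variable {G H : Type*} [Group G] [Group H]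

/-- The discrepancy between `x` and its image under a section of the abelianization. -/
def commutatorPart {s : Abelianization G → G} (hs : ∀ x, Abelianization.of (s x) = x) (x : G) :
    commutator G :=
  ⟨(s (Abelianization.of x))⁻¹ * x, by simp [mem_commutator_iff_abelianization_of_eq_one, hs]⟩

/-- The cross-effect of a section of the abelianization, as an element of the commutator. -/
def sectionCrossEff {s : Abelianization G → G} (hs : ∀ x, Abelianization.of (s x) = x)
    (x y : Abelianization G) : commutator G :=
  ⟨crossEff s x y, by simp [mem_commutator_iff_abelianization_of_eq_one, crossEff, hs]⟩

theorem mul_commutatorPart {s : Abelianization G → G} (hs : ∀ x, Abelianization.of (s x) = x)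
    (x : G) : s (Abelianization.of x) * commutatorPart hs x = x := by
  simp [commutatorPart]

theorem commutatorPart_mul {s : Abelianization G → G} (hs : ∀ x, Abelianization.of (s x) = x)
    (x : Abelianization G) (c : commutator G) : commutatorPart hs (s x * c) = c := by
  have hc := (mem_commutator_iff_abelianization_of_eq_one _).mp c.2
  ext
  simp [commutatorPart, hs, hc]

theorem commutatorPart_mul_mul (hG : commutator G ≤ Subgroup.center G)
    {s : Abelianization G → G} (hs : ∀ x, Abelianization.of (s x) = x) (a b : G) :
    commutatorPart hs (a * b) =
      (sectionCrossEff hs (Abelianization.of a) (Abelianization.of b))⁻¹ *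
        commutatorPart hs a * commutatorPart hs b := by
  have h := commute_of_mem_commutator hG (commutatorPart hs a).2 (s (Abelianization.of b))
  ext
  change (s (Abelianization.of (a * b)))⁻¹ * (a * b) =
    (crossEff s (Abelianization.of a) (Abelianization.of b))⁻¹ *
      (commutatorPart hs a : G) * (commutatorPart hs b : G)
  have hab : a * b = s (Abelianization.of a) * commutatorPart hs a *
      (s (Abelianization.of b) * commutatorPart hs b) := by
    rw [mul_commutatorPart, mul_commutatorPart]
  rw [map_mul, map_mul_eq_mul_crossEff s, hab, mul_assoc (s _) (commutatorPart hs a : G),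
    ← mul_assoc (commutatorPart hs a : G), h]
  group

/-- The map assembled, using sections of the abelianizations, from homomorphisms between
abelianizations and between commutator subgroups. -/
def twist {s : Abelianization G → G} (hs : ∀ x, Abelianization.of (s x) = x)
    (t : Abelianization H → H) (α : Abelianization G →* Abelianization H)
    (β : commutator G →* commutator H) (x : G) : H :=
  t (α (Abelianization.of x)) * β (commutatorPart hs x)

theorem twist_twist {s : Abelianization G → G} (hs : ∀ x, Abelianization.of (s x) = x)
    {t : Abelianization H → H} (ht : ∀ x, Abelianization.of (t x) = x)
    (α : Abelianization G ≃* Abelianization H) (β : commutator G ≃* commutator H) (x : G) :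
    twist ht s α.symm.toMonoidHom β.symm.toMonoidHom
      (twist hs t α.toMonoidHom β.toMonoidHom x) = x := by
  have hc := (mem_commutator_iff_abelianization_of_eq_one _).mp (β (commutatorPart hs x)).2
  simp [twist, commutatorPart_mul, ht, hc, mul_commutatorPart]

theorem crossEff_twist (hG : commutator G ≤ Subgroup.center G)
    (hH : commutator H ≤ Subgroup.center H)
    {s : Abelianization G → G} (hs : ∀ x, Abelianization.of (s x) = x)
    {t : Abelianization H → H} (ht : ∀ x, Abelianization.of (t x) = x)
    (α : Abelianization G →* Abelianization H) (β : commutator G →* commutator H) (a b : G) :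
    crossEff (twist hs t α β) a b =
      (sectionCrossEff ht (α (Abelianization.of a)) (α (Abelianization.of b)) *
        (β (sectionCrossEff hs (Abelianization.of a) (Abelianization.of b)))⁻¹ :
          commutator H) := by
  have key : ∀ u v c d e k : H, (∀ x, c * x = x * c) → (∀ x, e * x = x * e) →
      (∀ x, k * x = x * k) →
      (u * c * (v * d))⁻¹ * (u * v * k * (e * c * d)) = k * e := by
    intro u v c d e k hc he hk
    rw [inv_mul_eq_iff_eq_mul]
    calc u * v * k * (e * c * d) = u * v * ((k * e) * (c * d)) := by group
      _ = u * v * ((c * d) * (k * e)) := by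
        rw [mul_assoc k e, he (c * d), ← mul_assoc k, hk (c * d), mul_assoc (c * d), hk e]
      _ = u * (v * c) * d * (k * e) := by group
      _ = u * c * (v * d) * (k * e) := by rw [← hc v]; group
  rw [crossEff, twist, twist, twist, commutatorPart_mul_mul hG, map_mul, map_mul,
    map_mul_eq_mul_crossEff t, map_mul, map_mul, map_inv]
  exact key _ _ _ _ _ _ (commute_of_mem_commutator hH (β _).2)
    (commute_of_mem_commutator hH (β _)⁻¹.2)
    (commute_of_mem_commutator hH (sectionCrossEff ht _ _).2)

theorem isQMap_twist (hG : commutator G ≤ Subgroup.center G)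
    (hH : commutator H ≤ Subgroup.center H)
    {s : Abelianization G → G} (hs : ∀ x, Abelianization.of (s x) = x)
    (hsq : IsWeaklyQuadratic s)
    {t : Abelianization H → H} (ht : ∀ x, Abelianization.of (t x) = x)
    (htq : IsWeaklyQuadratic t)
    (α : Abelianization G →* Abelianization H) (β : commutator G →* commutator H) :
    IsQMap (twist hs t α β) := by
  have hmem (a b : G) : crossEff (twist hs t α β) a b ∈ commutator H := by
    rw [crossEff_twist hG hH hs ht]
    exact SetLike.coe_mem _
  have hcomm (x y : commutator H) : x * y = y * x :=
    Subtype.ext (commute_of_mem_commutator hH x.2 y)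
  have hdist (x y z w : commutator H) : x * y * (z * w)⁻¹ = x * z⁻¹ * (y * w⁻¹) := by
    rw [mul_inv_rev, hcomm w⁻¹, mul_assoc, ← mul_assoc y, hcomm y, mul_assoc, mul_assoc]
  refine ⟨⟨fun a b c => commute_of_mem_commutator hH (hmem a b) _, ?_, ?_⟩, hmem⟩
  · intro a a' b
    have h₁ (x y z) : sectionCrossEff hs (x * y) z =
      sectionCrossEff hs x z * sectionCrossEff hs y z := Subtype.ext (hsq.2.1 x y z)
    have h₂ (x y z) : sectionCrossEff ht (x * y) z =
      sectionCrossEff ht x z * sectionCrossEff ht y z := Subtype.ext (htq.2.1 x y z)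
    rw [crossEff_twist hG hH hs ht, crossEff_twist hG hH hs ht, crossEff_twist hG hH hs ht,
      ← Subgroup.coe_mul, map_mul, map_mul, h₁, h₂, map_mul, hdist]
  · intro a b b'
    have h₁ (x y z) : sectionCrossEff hs x (y * z) =
      sectionCrossEff hs x y * sectionCrossEff hs x z := Subtype.ext (hsq.2.2 x y z)
    have h₂ (x y z) : sectionCrossEff ht x (y * z) =
      sectionCrossEff ht x y * sectionCrossEff ht x z := Subtype.ext (htq.2.2 x y z)
    rw [crossEff_twist hG hH hs ht, crossEff_twist hG hH hs ht, crossEff_twist hG hH hs ht,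
      ← Subgroup.coe_mul, map_mul, map_mul, h₁, h₂, map_mul, hdist]

end Twist

/-- Two q-split nil₂-groups are isomorphic in `Niq` iff they are similar, i.e. have
isomorphic abelianizations and isomorphic commutator subgroups. -/
theorem stmt_17 {G H : Type*} [Group G] [Group H]
    (hG : commutator G ≤ Subgroup.center G) (hH : commutator H ≤ Subgroup.center H)
    (hGs : QSplit G) (hHs : QSplit H) :
    (∃ (f : G → H) (g : H → G), IsQMap f ∧ IsQMap g ∧ g ∘ f = id ∧ f ∘ g = id) ↔
    (Nonempty (Abelianization G ≃* Abelianization H) ∧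
      Nonempty (↥(commutator G) ≃* ↥(commutator H))) := by
  constructor
  · rintro ⟨f, g, hf, hg, hgf, hfg⟩
    refine ⟨⟨MonoidHom.toMulEquiv hf.abelianizationMap hg.abelianizationMap ?_ ?_⟩,
      ⟨MonoidHom.toMulEquiv (hf.commutatorMap hH) (hg.commutatorMap hG) ?_ ?_⟩⟩
    · ext x
      simpa [IsQMap.abelianizationMap_of] using
        congrArg Abelianization.of (congrFun hgf x)
    · ext x
      simpa [IsQMap.abelianizationMap_of] using
        congrArg Abelianization.of (congrFun hfg x)
    · ext x
      exact congrFun hgf x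
    · ext x
      exact congrFun hfg x
  · rintro ⟨⟨α⟩, ⟨β⟩⟩
    obtain ⟨s, hsq, hs⟩ := hGs
    obtain ⟨t, htq, ht⟩ := hHs
    exact ⟨twist hs t α.toMonoidHom β.toMonoidHom,
      twist ht s α.symm.toMonoidHom β.symm.toMonoidHom,
      isQMap_twist hG hH hs hsq.1 ht htq.1 _ _, isQMap_twist hH hG ht htq.1 hs hsq.1 _ _,
      funext (twist_twist hs ht α β), funext (twist_twist ht hs α.symm β.symm)⟩
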